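/- arXiv:2207.00817 — 2 statements merged into one kernel-verified Lean document; each statement's English description precedes it below -/
import Mathlib

section
/- Let R = ⨁_{s∈S} R_s be an S-graded ring inducing S which is nearly epsilon-strongly graded. Then R_e·R_f = 0 for all distinct idempotent elements e, f ∈ S. -/
/-- `S` is cancellative: `0 ≠ su = tu` implies `s = t`, and `0 ≠ us = ut` implies `s = t`. -/
def SCancellative (S : Type*) [Mul S] [Zero S] : Prop :=
  (∀ s t u : S, s * u ≠ 0 → s * u = t * u → s = t) ∧
  (∀ s t u : S, u * s ≠ 0 → u * s = u * t → s = t)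

/-- `t` is an (LRI)-inverse of `s`: there are idempotents `e, f` with
`es = sf = s`, `ft = te = t`, `st = e` and `ts = f`. -/
def LRIWitness {S : Type*} [Mul S] (s t : S) : Prop :=
  ∃ e f : S, e * e = e ∧ f * f = f ∧ e * s = s ∧ s * f = s ∧
    f * t = t ∧ t * e = t ∧ s * t = e ∧ t * s = f

/-- `S` satisfies the (LRI) condition. -/
def SLRI (S : Type*) [Mul S] : Prop := ∀ s : S, ∃ t : S, LRIWitness s t

/-- An `S`-graded ring inducing `S`: a family of additive subgroups `comp s` of `R`
forming an internal direct sum, with `comp 0 = 0` and `comp s * comp t ⊆ comp (s*t)`;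
the zero of `S` absorbs multiplication. -/
structure SGradedRing (S R : Type*) [Mul S] [Zero S] [DecidableEq S] [NonUnitalRing R] where
  comp : S → AddSubgroup R
  zero_mul' : ∀ s : S, (0 : S) * s = 0
  mul_zero' : ∀ s : S, s * (0 : S) = 0
  comp_zero : comp (0 : S) = ⊥
  mul_mem' : ∀ {s t : S} {x y : R}, x ∈ comp s → y ∈ comp t → x * y ∈ comp (s * t)
  isInternal : DirectSum.IsInternal comp

variable {S R : Type*} [Mul S] [Zero S] [DecidableEq S] [NonUnitalRing R]

/-- `x` is a homogeneous element. -/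
def SGradedRing.IsHomog (G : SGradedRing S R) (x : R) : Prop := ∃ s : S, x ∈ G.comp s

/-- `R` is graded von Neumann regular: `x ∈ xRx` for every homogeneous `x`. -/
def SGradedRing.GradedVNRegular (G : SGradedRing S R) : Prop :=
  ∀ x : R, G.IsHomog x → ∃ r : R, x = x * r * x

/-- The additive subgroup generated by products `a * b`, `a ∈ A`, `b ∈ B`. -/
def subgroupMul (A B : AddSubgroup R) : AddSubgroup R :=
  AddSubgroup.closure {x : R | ∃ a ∈ A, ∃ b ∈ B, x = a * b}

/-- `R` is nearly epsilon-strongly graded. -/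
def SGradedRing.NearlyEpsilonStrong (G : SGradedRing S R) : Prop :=
  SCancellative S ∧ SLRI S ∧
  ∀ s : S, ∀ x ∈ G.comp s, ∃ t : S, LRIWitness s t ∧
    ∃ ε ∈ subgroupMul (G.comp s) (G.comp t), ∃ ε' ∈ subgroupMul (G.comp t) (G.comp s),
      ε * x = x ∧ x * ε' = x

/-- `R` is epsilon-strongly graded. -/
def SGradedRing.EpsilonStrong (G : SGradedRing S R) : Prop :=
  SCancellative S ∧
  ∃ inv : S → S, (∀ s : S, LRIWitness s (inv s)) ∧
    ∃ ε : S → R, ∀ s : S, ε s ∈ subgroupMul (G.comp s) (G.comp (inv s)) ∧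
      ∀ x ∈ G.comp s, ε s * x = x ∧ x * ε (inv s) = x

/-- `R` is strongly graded. -/
def SGradedRing.StronglyGraded (G : SGradedRing S R) : Prop :=
  ∀ s t : S, subgroupMul (G.comp s) (G.comp t) = G.comp (s * t)

/-- `R` is pseudo-unitary. -/
def SGradedRing.PseudoUnitary (G : SGradedRing S R) : Prop :=
  SCancellative S ∧
  ∃ u : S → R,
    (∀ e : S, e * e = e → u e ∈ G.comp e ∧ ∀ x ∈ G.comp e, u e * x = x ∧ x * u e = x) ∧
    (∀ x : R, G.IsHomog x → ∃ e f : S, e * e = e ∧ f * f = f ∧ u e * x = x ∧ x * u f = x)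

/-- A right ideal `I` is homogeneous if it is generated by its homogeneous elements,
equivalently `I = ⨁ₛ (Rₛ ∩ I)`. -/
def SGradedRing.HomogClosed (G : SGradedRing S R) (I : AddSubgroup R) : Prop :=
  I = AddSubgroup.closure {x : R | x ∈ I ∧ G.IsHomog x}

theorem SGradedRing.eq_of_mem_of_mem (G : SGradedRing S R) {s t : S} {x : R}
    (hs : x ∈ G.comp s) (ht : x ∈ G.comp t) (hx : x ≠ 0) : s = t := by
  by_contra hst
  have hd := G.isInternal.addSubgroup_iSupIndep.pairwiseDisjoint hst
  exact hx (AddSubgroup.disjoint_def.mp hd hs ht)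

/-- An idempotent other than `0` has itself as its only (LRI)-inverse. -/
theorem SCancellative.eq_of_lriWitness {T : Type*} [Mul T] [Zero T] (hS : SCancellative T)
    {e t : T} (he : e * e = e) (he0 : e ≠ 0) (h : LRIWitness e t) : t = e := by
  obtain ⟨p, q, -, -, hpe, -, -, -, hep, -⟩ := h
  have hp : p = e := (hS.1 e p e (by rwa [he]) (by rw [he, hpe])).symm
  exact (hS.2 e t e (by rwa [he]) (by rw [he, hep, hp])).symm

theorem SGradedRing.subgroupMul_le (G : SGradedRing S R) (s t : S) :
    subgroupMul (G.comp s) (G.comp t) ≤ G.comp (s * t) := by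
  rw [subgroupMul, AddSubgroup.closure_le]
  rintro _ ⟨a, ha, b, hb, rfl⟩
  exact G.mul_mem' ha hb

/-- In a nearly epsilon-strongly graded ring, `R_e · R_f = 0` for distinct idempotents
`e, f ∈ S`. -/
theorem stmt4 (G : SGradedRing S R) (h : G.NearlyEpsilonStrong)
    (e f : S) (he : e * e = e) (hf : f * f = f) (hef : e ≠ f) :
    subgroupMul (G.comp e) (G.comp f) = ⊥ := by
  rw [subgroupMul, AddSubgroup.closure_eq_bot_iff]
  rintro _ ⟨x, hx, y, hy, rfl⟩
  by_contra hxy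
  replace hxy : x * y ≠ 0 := hxy
  obtain ⟨hS, -, hε⟩ := h
  have hmem := G.mul_mem' hx hy
  have hef0 : e * f ≠ 0 := by
    intro h0
    rw [h0, G.comp_zero] at hmem
    exact hxy hmem
  have he0 : e ≠ 0 := by
    rintro rfl
    exact hef0 (G.zero_mul' f)
  have hf0 : f ≠ 0 := by
    rintro rfl
    exact hef0 (G.mul_zero' e)
  obtain ⟨t, ht, -, -, ε', hε', -, hxε'⟩ := hε e x hx
  obtain rfl := hS.eq_of_lriWitness he he0 ht
  have hε'e := G.subgroupMul_le _ _ hε'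
  rw [he] at hε'e
  have hmem' := G.mul_mem' hx (G.mul_mem' hε'e hy)
  rw [← mul_assoc, hxε'] at hmem'
  have hidx := G.eq_of_mem_of_mem hmem hmem' hxy
  have hff := hS.2 _ _ _ hef0 hidx
  exact hef (hS.1 f _ f (by rwa [hf]) (by rw [hf, ← hff])).symm
end

section
/- Let R = ⨁_{s∈S} R_s be an S-graded ring inducing S with S cancellative, and assume R_s ≠ 0 for every s ∈ S∖{0}. Then R is graded von Neumann regular if and only if R is nearly epsilon-strongly graded and the ring R_e is von Neumann regular for every idempotent element e ∈ S. -/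
variable {S R : Type*} [Mul S] [Zero S] [DecidableEq S] [NonUnitalRing R]

/-- The only (LRI)-inverse of an idempotent is the idempotent itself. -/
theorem LRIWitness.eq_of_idempotent {S : Type*} [Mul S] [Zero S] (hc : SCancellative S) {e t : S}
    (h0 : e ≠ 0) (he : e * e = e) (h : LRIWitness e t) : t = e := by
  obtain ⟨e', f', -, -, h1, -, -, -, h2, -⟩ := h
  have h3 : e' = e := hc.1 e' e e (by rwa [h1]) (h1.trans he.symm)
  have h4 : e * t = e := h2.trans h3
  exact hc.2 t e e (by rwa [h4]) (h4.trans he.symm)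

theorem mul_mem_subgroupMul {A B : AddSubgroup R} {a b : R} (ha : a ∈ A) (hb : b ∈ B) :
    a * b ∈ subgroupMul A B :=
  AddSubgroup.subset_closure ⟨a, ha, b, hb, rfl⟩

namespace SGradedRing

theorem mul_mem_of_eq (G : SGradedRing S R) {s t u : S} (h : s * t = u) {x y : R}
    (hx : x ∈ G.comp s) (hy : y ∈ G.comp t) : x * y ∈ G.comp u :=
  h ▸ G.mul_mem' hx hy

theorem lriWitness_zero (G : SGradedRing S R) : LRIWitness (0 : S) 0 :=
  have h := G.zero_mul' 0
  ⟨0, 0, h, h, h, h, h, h, h, h⟩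

theorem degree_ne_zero (G : SGradedRing S R) {s : S} {x : R} (hx : x ∈ G.comp s) (h0 : x ≠ 0) :
    s ≠ 0 := by
  rintro rfl
  rw [G.comp_zero] at hx
  exact h0 (AddSubgroup.mem_bot.1 hx)

/-- A nonzero homogeneous element has a unique degree. -/
theorem degree_unique (G : SGradedRing S R) {s t : S} {x : R} (hs : x ∈ G.comp s)
    (ht : x ∈ G.comp t) (h0 : x ≠ 0) : s = t := by
  let := G.isInternal.chooseDecomposition
  exact DirectSum.degree_eq_of_mem_mem G.comp hs ht h0

/-- Distinct `t` cannot both satisfy `(st)s = s` when `s ≠ 0`. -/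
theorem eq_of_mul_mul_eq (G : SGradedRing S R) (hc : SCancellative S) {s t t' : S} (h0 : s ≠ 0)
    (h : s * t * s = s) (h' : s * t' * s = s) : t = t' := by
  have hst : s * t ≠ 0 := fun h1 => h0 (by rw [← h, h1, G.zero_mul'])
  exact hc.2 _ _ _ hst (hc.1 _ _ _ (by rwa [h]) (h.trans h'.symm))

/-- A quasi-inverse of a nonzero homogeneous element can be chosen homogeneous. -/
theorem exists_homogeneous_quasi_inverse (G : SGradedRing S R) (hc : SCancellative S) {s : S}
    {x r : R} (hx : x ∈ G.comp s) (h0 : x ≠ 0) (hr : x = x * r * x) :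
    ∃ t : S, s * t * s = s ∧ ∃ y ∈ G.comp t, x = x * y * x := by
  classical
  let := G.isInternal.chooseDecomposition
  have hs := G.degree_ne_zero hx h0
  have hsum : x = ∑ t ∈ (DirectSum.decompose G.comp r).support,
      (DirectSum.decompose G.comp (x * (DirectSum.decompose G.comp r t : R) * x) s : R) := by
    have h1 : (DirectSum.decompose G.comp (x * r * x) s : R) = x := by
      rw [← hr, DirectSum.decompose_of_mem_same G.comp hx]
    conv_lhs => rw [← h1, ← DirectSum.sum_support_decompose G.comp r]
    rw [Finset.mul_sum, Finset.sum_mul, DirectSum.decompose_sum, DFinsupp.finsetSum_apply,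
      AddSubgroup.val_finsetSum]
  have hmem (t : S) : x * (DirectSum.decompose G.comp r t : R) * x ∈ G.comp (s * t * s) :=
    G.mul_mem' (G.mul_mem' hx (SetLike.coe_mem _)) hx
  have hvanish (t : S) (ht : s * t * s ≠ s) :
      (DirectSum.decompose G.comp (x * (DirectSum.decompose G.comp r t : R) * x) s : R) = 0 :=
    DirectSum.decompose_of_mem_ne G.comp (hmem t) ht
  by_cases hex : ∃ t : S, s * t * s = s
  · obtain ⟨t, ht⟩ := hex
    refine ⟨t, ht, DirectSum.decompose G.comp r t, SetLike.coe_mem _, ?_⟩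
    rw [Finset.sum_eq_single t] at hsum
    · rwa [DirectSum.decompose_of_mem_same G.comp (by simpa only [ht] using hmem t)] at hsum
    · intro t' _ hne
      exact hvanish t' fun h => hne (G.eq_of_mul_mul_eq hc hs h ht)
    · intro h
      simp [DFinsupp.notMem_support_iff.1 h]
  · exact absurd (hsum.trans (Finset.sum_eq_zero fun t _ => hvanish t fun h => hex ⟨t, h⟩)) h0

/-- The degree of a homogeneous quasi-inverse of `x ≠ 0` is an (LRI)-inverse of the degree
of `x`. -/
theorem exists_lriWitness_quasi_inverse (G : SGradedRing S R) (hc : SCancellative S) {s : S}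
    {x r : R} (hx : x ∈ G.comp s) (h0 : x ≠ 0) (hr : x = x * r * x) :
    ∃ t : S, LRIWitness s t ∧ ∃ y ∈ G.comp t, x = x * y * x := by
  obtain ⟨t, ht, y, hy, hxy⟩ := G.exists_homogeneous_quasi_inverse hc hx h0 hr
  have hs := G.degree_ne_zero hx h0
  have hxym := G.mul_mem' hx hy
  have hyxm := G.mul_mem' hy hx
  have hxyx : x * (y * x) = x := by rw [← mul_assoc, ← hxy]
  have hxyxyx : x * (y * x * y) * x = x := by rw [← mul_assoc, hxyx, ← hxy]
  have hyxy : y * x * y ≠ 0 := fun h => h0 (by rw [← hxyxyx, h, mul_zero, zero_mul])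
  have hright : t * s * t = t * (s * t) :=
    G.degree_unique (G.mul_mem' hyxm hy) (mul_assoc y x y ▸ G.mul_mem' hy hxym) hyxy
  have hleft : t * s * t = t := by
    refine G.eq_of_mul_mul_eq hc hs (G.degree_unique (x := x) ?_ hx h0) ht
    have := G.mul_mem' (G.mul_mem' hx (G.mul_mem' hyxm hy)) hx
    rwa [hxyxyx] at this
  refine ⟨t, ⟨s * t, t * s, ?_, ?_, ht, ?_, hleft, ?_, rfl, rfl⟩, y, hy, hxy⟩
  · refine G.degree_unique (x := x * y) ?_ hxym fun h => h0 (by rw [hxy, h, zero_mul])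
    have := G.mul_mem' hxym hxym
    rwa [← mul_assoc, ← hxy] at this
  · refine G.degree_unique (x := y * x) ?_ hyxm fun h => h0 (by rw [← hxyx, h, mul_zero])
    have := G.mul_mem' hyxm hyxm
    rwa [mul_assoc, hxyx] at this
  · exact G.degree_unique (hxyx ▸ G.mul_mem' hx hyxm) hx h0
  · rw [← hright, hleft]

/-- If the component `R_{st}` is von Neumann regular, then for every `η ∈ R_t R_s` an element
`c ∈ R_t` can be modified so that `x * c` fixes `x * η` on the left, while `x * c` still fixes
everything it fixed before. -/
theorem exists_left_fixing (G : SGradedRing S R) {s t : S} (hte : t * (s * t) = t)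
    (hreg : ∀ z ∈ G.comp (s * t), ∃ y ∈ G.comp (s * t), z = z * y * z) {x η : R}
    (hx : x ∈ G.comp s) (hη : η ∈ subgroupMul (G.comp t) (G.comp s)) :
    ∀ c ∈ G.comp t, ∃ c' ∈ G.comp t,
      (∀ w, x * c * w = w → x * c' * w = w) ∧ x * c' * (x * η) = x * η := by
  induction hη using AddSubgroup.closure_induction with
  | mem η h =>
    obtain ⟨b, hb, a, -, rfl⟩ := h
    intro c hcm
    have hd : b - c * (x * b) ∈ G.comp t :=
      sub_mem hb (G.mul_mem_of_eq hte hcm (G.mul_mem' hx hb))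
    obtain ⟨y, hy, hz⟩ := hreg _ (G.mul_mem' hx hd)
    have hdy := G.mul_mem_of_eq hte hd hy
    set d := b - c * (x * b) with hd_def
    refine ⟨c + d * y - d * y * (x * c),
      sub_mem (add_mem hcm hdy) (G.mul_mem_of_eq hte hdy (G.mul_mem' hx hcm)), ?_, ?_⟩
    · intro w hw
      have key : x * (c + d * y - d * y * (x * c)) * w =
          x * c * w + x * d * y * w - x * d * y * (x * c * w) := by noncomm_ring
      rw [key, hw, add_sub_cancel_right]
    · have key : x * (c + d * y - d * y * (x * c)) * (x * (b * a)) =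
          (x * c * x * b + x * d * y * (x * (b - c * (x * b)))) * a := by noncomm_ring
      rw [key, ← hd_def, ← hz, hd_def]
      noncomm_ring
  | zero => exact fun c hcm => ⟨c, hcm, fun _ h => h, by simp⟩
  | add η₁ η₂ _ _ ih₁ ih₂ =>
    intro c hcm
    obtain ⟨c₁, hc₁, hfix₁, h₁⟩ := ih₁ c hcm
    obtain ⟨c₂, hc₂, hfix₂, h₂⟩ := ih₂ c₁ hc₁
    exact ⟨c₂, hc₂, fun w hw => hfix₂ w (hfix₁ w hw), by
      rw [mul_add x η₁, mul_add, hfix₂ _ h₁, h₂]⟩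
  | neg η _ ih =>
    intro c hcm
    obtain ⟨c', hc', hfix, h⟩ := ih c hcm
    exact ⟨c', hc', hfix, by rw [mul_neg x η, mul_neg, h]⟩

theorem GradedVNRegular.nearlyEpsilonStrong {G : SGradedRing S R} (h : G.GradedVNRegular)
    (hc : SCancellative S) (hnz : ∀ s : S, s ≠ 0 → G.comp s ≠ ⊥) : G.NearlyEpsilonStrong := by
  have hlri : SLRI S := by
    intro s
    by_cases hs : s = 0
    · exact ⟨0, hs ▸ G.lriWitness_zero⟩
    · obtain ⟨x, hx, h0⟩ := (G.comp s).bot_or_exists_ne_zero.resolve_left (hnz s hs)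
      obtain ⟨r, hr⟩ := h x ⟨s, hx⟩
      obtain ⟨t, ht, -⟩ := G.exists_lriWitness_quasi_inverse hc hx h0 hr
      exact ⟨t, ht⟩
  refine ⟨hc, hlri, fun s x hx => ?_⟩
  by_cases h0 : x = 0
  · obtain ⟨t, ht⟩ := hlri s
    exact ⟨t, ht, 0, zero_mem _, 0, zero_mem _, by simp [h0], by simp [h0]⟩
  · obtain ⟨r, hr⟩ := h x ⟨s, hx⟩
    obtain ⟨t, ht, y, hy, hxy⟩ := G.exists_lriWitness_quasi_inverse hc hx h0 hr
    exact ⟨t, ht, x * y, mul_mem_subgroupMul hx hy, y * x, mul_mem_subgroupMul hy hx,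
      hxy.symm, by rw [← mul_assoc, ← hxy]⟩

theorem GradedVNRegular.comp_idempotent {G : SGradedRing S R} (h : G.GradedVNRegular)
    (hc : SCancellative S) {e : S} (he : e * e = e) {x : R} (hx : x ∈ G.comp e) :
    ∃ y ∈ G.comp e, x = x * y * x := by
  by_cases h0 : x = 0
  · exact ⟨0, zero_mem _, by simp [h0]⟩
  · obtain ⟨r, hr⟩ := h x ⟨e, hx⟩
    obtain ⟨t, ht, y, hy, hxy⟩ := G.exists_lriWitness_quasi_inverse hc hx h0 hr
    exact ⟨y, ht.eq_of_idempotent hc (G.degree_ne_zero hx h0) he ▸ hy, hxy⟩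

theorem NearlyEpsilonStrong.gradedVNRegular {G : SGradedRing S R} (h : G.NearlyEpsilonStrong)
    (hreg : ∀ e : S, e * e = e → ∀ x ∈ G.comp e, ∃ y ∈ G.comp e, x = x * y * x) :
    G.GradedVNRegular := by
  rintro x ⟨s, hx⟩
  obtain ⟨t, ⟨e, f, he, -, -, -, -, hte, rfl, -⟩, -, -, ε', hε', -, hxε'⟩ := h.2.2 s x hx
  obtain ⟨c, -, -, hfix⟩ := G.exists_left_fixing hte (hreg _ he) hx hε' 0 (zero_mem _)
  rw [hxε'] at hfix
  exact ⟨c, hfix.symm⟩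

end SGradedRing

/-- Main characterization: with `S` cancellative and all components over `S \ {0}`
nonzero, `R` is graded von Neumann regular iff `R` is nearly epsilon-strongly graded
and every ring component `R_e` (`e` idempotent) is von Neumann regular. -/
theorem stmt10 (G : SGradedRing S R) (hc : SCancellative S)
    (hnz : ∀ s : S, s ≠ 0 → G.comp s ≠ ⊥) :
    G.GradedVNRegular ↔
      (G.NearlyEpsilonStrong ∧ ∀ e : S, e * e = e →
        ∀ x ∈ G.comp e, ∃ y ∈ G.comp e, x = x * y * x) := by
  refine ⟨fun h => ⟨h.nearlyEpsilonStrong hc hnz, fun e he x hx => h.comp_idempotent hc he hx⟩,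
    fun h => h.1.gradedVNRegular h.2⟩
end
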